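/- Let X be a complete CAT(-1) space and K ⊆ X a nonempty closed convex subset. Then every nonexpansive mapping T: K → K has a fixed point if and only if K is geodesically bounded (i.e., K contains no geodesic ray). -/

import Mathlib

/-- `p` lies on a geodesic segment between `x` and `y`. -/
def MetricBtw {X : Type*} [MetricSpace X] (x p y : X) : Prop :=
  dist x p + dist p y = dist x y

/-- `X` is a geodesic metric space: any two points are joined by a segment,
realized pointwise at every ratio `t ∈ [0,1]`. -/
def IsGeodesicSpace (X : Type*) [MetricSpace X] : Prop :=
  ∀ x y : X, ∀ t : ℝ, t ∈ Set.Icc (0 : ℝ) 1 →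
    ∃ p : X, dist x p = t * dist x y ∧ MetricBtw x p y

/-- A subset is (geodesically) convex. -/
def MetricConvex {X : Type*} [MetricSpace X] (K : Set X) : Prop :=
  ∀ x ∈ K, ∀ y ∈ K, ∀ p : X, MetricBtw x p y → p ∈ K

/-- The CAT(-1) comparison inequality: distances between points on the sides of a
triangle are bounded by the corresponding distances in a comparison triangle in the
hyperbolic plane `ℍ²` (the upper half-plane with its hyperbolic metric). -/
def IsCatMinusOne (X : Type*) [MetricSpace X] : Prop :=
  ∀ x y z p q : X, MetricBtw x p y → MetricBtw x q z →
    ∀ x' y' z' p' q' : UpperHalfPlane,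
      dist x' y' = dist x y → dist x' z' = dist x z → dist y' z' = dist y z →
      MetricBtw x' p' y' → dist x' p' = dist x p →
      MetricBtw x' q' z' → dist x' q' = dist x q →
      dist p q ≤ dist p' q'

/-- The CAT(0) comparison inequality (comparison triangles in the Euclidean plane). -/
def IsCatZero (X : Type*) [MetricSpace X] : Prop :=
  ∀ x y z p q : X, MetricBtw x p y → MetricBtw x q z →
    ∀ x' y' z' p' q' : EuclideanSpace ℝ (Fin 2),
      dist x' y' = dist x y → dist x' z' = dist x z → dist y' z' = dist y z →
      MetricBtw x' p' y' → dist x' p' = dist x p →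
      MetricBtw x' q' z' → dist x' q' = dist x q →
      dist p q ≤ dist p' q'

/-- The CAT(κ) comparison inequality for `κ < 0`: the model space `M²_κ` is the
hyperbolic plane with distance multiplied by `1/√(-κ)`, so comparison triangles in
`ℍ²` have side lengths `√(-κ)` times those in `X`. -/
def IsCatNeg (κ : ℝ) (X : Type*) [MetricSpace X] : Prop :=
  ∀ x y z p q : X, MetricBtw x p y → MetricBtw x q z →
    ∀ x' y' z' p' q' : UpperHalfPlane,
      dist x' y' = Real.sqrt (-κ) * dist x y →
      dist x' z' = Real.sqrt (-κ) * dist x z →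
      dist y' z' = Real.sqrt (-κ) * dist y z →
      MetricBtw x' p' y' → dist x' p' = Real.sqrt (-κ) * dist x p →
      MetricBtw x' q' z' → dist x' q' = Real.sqrt (-κ) * dist x q →
      Real.sqrt (-κ) * dist p q ≤ dist p' q'

/-- The CAT(κ) condition for `κ ≤ 0`. -/
def IsCatK (κ : ℝ) (X : Type*) [MetricSpace X] : Prop :=
  if κ < 0 then IsCatNeg κ X else IsCatZero X

/-- Euclidean comparison angle determined by the three side lengths. -/
noncomputable def compAngle (a b c : ℝ) : ℝ :=
  Real.arccos ((a ^ 2 + b ^ 2 - c ^ 2) / (2 * a * b))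

/-- The Alexandrov angle at `x` between `y` and `z`, defined (as is valid in CAT(0)
spaces) as the infimum of Euclidean comparison angles over points on the segments. -/
noncomputable def alexAngle {X : Type*} [MetricSpace X] (x y z : X) : ℝ :=
  sInf {θ : ℝ | ∃ p q : X, MetricBtw x p y ∧ MetricBtw x q z ∧ p ≠ x ∧ q ≠ x ∧
    θ = compAngle (dist x p) (dist x q) (dist p q)}

/-- `K` is geodesically bounded: it contains no geodesic ray. -/
def GeodesicallyBounded {X : Type*} [MetricSpace X] (K : Set X) : Prop :=
  ¬ ∃ c : ℝ → X, (∀ s t : ℝ, 0 ≤ s → 0 ≤ t → dist (c s) (c t) = |s - t|) ∧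
      ∀ t : ℝ, 0 ≤ t → c t ∈ K


open Real
theorem sinh_abs_lt_cosh (r c s : ℝ) (h : c^2+s^2=1) : 0 < cosh r - sinh r * c := by
  have h1 := Real.cosh_sq r
  have h2 := Real.cosh_pos r
  by_contra! h3
  have : cosh r ^2 ≤ (sinh r * c)^2 := by gcongr; linarith
  nlinarith [sq_nonneg (sinh r * s), sq_nonneg s, sq_nonneg (sinh r)]

noncomputable def hp (r c s : ℝ) (h : c^2+s^2=1) : UpperHalfPlane :=
  ⟨⟨sinh r * s / (cosh r - sinh r * c), 1 / (cosh r - sinh r * c)⟩,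
    one_div_pos.2 (sinh_abs_lt_cosh r c s h)⟩

theorem cosh_dist_hp (r c s r' c' s' : ℝ) (h : c^2+s^2=1) (h' : c'^2+s'^2=1) :
    cosh (dist (hp r c s h) (hp r' c' s' h')) =
      cosh r * cosh r' - sinh r * sinh r' * (c * c' + s * s') := by
  rw [UpperHalfPlane.cosh_dist]
  have p1 := sinh_abs_lt_cosh r c s h
  have p2 := sinh_abs_lt_cosh r' c' s' h'
  have e1 : (hp r c s h : ℂ) = ⟨sinh r * s / (cosh r - sinh r * c), 1 / (cosh r - sinh r * c)⟩ := rfl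
  have e2 : (hp r' c' s' h' : ℂ) = ⟨sinh r' * s' / (cosh r' - sinh r' * c'), 1 / (cosh r' - sinh r' * c')⟩ := rfl
  have e3 : (hp r c s h).im = 1 / (cosh r - sinh r * c) := rfl
  have e4 : (hp r' c' s' h').im = 1 / (cosh r' - sinh r' * c') := rfl
  rw [e3, e4, e1, e2, Complex.dist_eq_re_im, Real.sq_sqrt (by positivity)]
  have q1 : (cosh r - sinh r * c) * (cosh r + sinh r * c) = 1 + (sinh r * s)^2 := by
    have := Real.cosh_sq r
    linear_combination this - sinh r^2 * h
  have q2 : (cosh r' - sinh r' * c') * (cosh r' + sinh r' * c') = 1 + (sinh r' * s')^2 := by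
    have := Real.cosh_sq r'
    linear_combination this - sinh r'^2 * h'
  have k : cosh r * cosh r' - sinh r * sinh r' * (c * c' + s * s') =
    ((cosh r - sinh r * c) * (cosh r' + sinh r' * c') + (cosh r + sinh r * c) * (cosh r' - sinh r' * c'))/2 - (sinh r * s) * (sinh r' * s') := by ring
  rw [k]
  generalize cosh r - sinh r * c = A at *
  generalize cosh r' - sinh r' * c' = A' at *
  generalize sinh r * s = u at *
  generalize sinh r' * s' = u' at *
  have b1 : cosh r + sinh r * c = (1 + u^2)/A := by field_simp; linarith
  have b2 : cosh r' + sinh r' * c' = (1 + u'^2)/A' := by field_simp; linarith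
  rw [b1, b2]
  field_simp
  ring

theorem cosh_mono {a b : ℝ} (ha : 0 ≤ a) (h : a ≤ b) : cosh a ≤ cosh b :=
  Real.cosh_le_cosh.2 (by rwa [abs_of_nonneg ha, abs_of_nonneg (ha.trans h)])

theorem cosh_inj' {a b : ℝ} (ha : 0 ≤ a) (hb : 0 ≤ b) (h : cosh a = cosh b) : a = b := by
  have := Real.cosh_abs a
  have h1 : |a| ≤ |b| := Real.cosh_le_cosh.1 h.le
  have h2 : |b| ≤ |a| := Real.cosh_le_cosh.1 h.ge
  rw [abs_of_nonneg ha, abs_of_nonneg hb] at *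
  linarith

theorem exists_c (R R' D : ℝ) (hR : 0 ≤ R) (hR' : 0 ≤ R') (hD : 0 ≤ D) (h1 : |R - R'| ≤ D) (h2 : D ≤ R + R') :
    ∃ c : ℝ, -1 ≤ c ∧ c ≤ 1 ∧ cosh D = cosh R * cosh R' - sinh R * sinh R' * c := by
  have k1 : cosh (R - R') ≤ cosh D := Real.cosh_le_cosh.2 (by rwa [abs_of_nonneg hD])
  have k2 : cosh D ≤ cosh (R + R') := Real.cosh_le_cosh.2 (by rwa [abs_of_nonneg hD, abs_of_nonneg (by positivity)])
  rw [Real.cosh_sub] at k1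
  rw [Real.cosh_add] at k2
  have s1 := Real.sinh_nonneg_iff.2 hR
  have s2 := Real.sinh_nonneg_iff.2 hR'
  rcases (mul_nonneg s1 s2).eq_or_lt with h | h
  · exact ⟨1, by norm_num, le_rfl, by linarith⟩
  · refine ⟨(cosh R * cosh R' - cosh D) / (sinh R * sinh R'), ?_, ?_, ?_⟩
    · rw [le_div_iff₀ h]; linarith
    · rw [div_le_iff₀ h]; linarith
    · rw [mul_div_cancel₀ _ h.ne']; ring

theorem comp {X : Type*} [MetricSpace X] (hcat : IsCatMinusOne X) (o x y : X) :
    ∃ c : ℝ, -1 ≤ c ∧ c ≤ 1 ∧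
      cosh (dist x y) = cosh (dist o x) * cosh (dist o y) - sinh (dist o x) * sinh (dist o y) * c ∧
      ∀ p q, MetricBtw o p x → MetricBtw o q y →
        cosh (dist p q) ≤ cosh (dist o p) * cosh (dist o q) - sinh (dist o p) * sinh (dist o q) * c := by
  obtain ⟨c, h1, h2, h3⟩ := exists_c (dist o x) (dist o y) (dist x y) dist_nonneg dist_nonneg dist_nonneg
    (by rw [dist_comm o x, dist_comm o y]; exact abs_dist_sub_le x y o) (by rw [dist_comm o x]; exact dist_triangle _ _ _)
  refine ⟨c, h1, h2, h3, fun p q hp1 hq1 => ?_⟩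
  have hs : c^2 + (√(1 - c^2))^2 = 1 := by rw [Real.sq_sqrt (by nlinarith)]; ring
  have h10 : (1:ℝ)^2 + 0^2 = 1 := by norm_num
  have key : ∀ (r c s : ℝ) (h : c^2+s^2=1), 0 ≤ r → dist (hp 0 1 0 h10) (hp r c s h) = r := fun r c s h hr =>
    cosh_inj' dist_nonneg hr (by rw [cosh_dist_hp]; simp)
  have key2 : ∀ (r r' c s : ℝ) (h : c^2+s^2=1), r ≤ r' → dist (hp r c s h) (hp r' c s h) = r' - r := fun r r' c s h hr =>
    cosh_inj' dist_nonneg (by linarith) (by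
      rw [cosh_dist_hp, Real.cosh_sub]; linear_combination (- sinh r * sinh r') * h)
  have op := dist_nonneg (x := o) (y := p)
  have oq := dist_nonneg (x := o) (y := q)
  have ox := dist_nonneg (x := o) (y := x)
  have oy := dist_nonneg (x := o) (y := y)
  have px : dist o p ≤ dist o x := by unfold MetricBtw at hp1; linarith [dist_nonneg (x := p) (y := x)]
  have qy : dist o q ≤ dist o y := by unfold MetricBtw at hq1; linarith [dist_nonneg (x := q) (y := y)]
  have := hcat o x y p q hp1 hq1 (hp 0 1 0 h10) (hp (dist o x) 1 0 h10) (hp (dist o y) c _ hs)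
    (hp (dist o p) 1 0 h10) (hp (dist o q) c _ hs) (key _ _ _ _ ox) (key _ _ _ _ oy)
    (cosh_inj' dist_nonneg dist_nonneg (by rw [cosh_dist_hp, h3]; ring))
    (by unfold MetricBtw; rw [key _ _ _ _ op, key _ _ _ _ ox, key2 _ _ _ _ _ px]; ring)
    (key _ _ _ _ op)
    (by unfold MetricBtw; rw [key _ _ _ _ oq, key _ _ _ _ oy, key2 _ _ _ _ _ qy]; ring)
    (key _ _ _ _ oq)
  have h5 := cosh_mono dist_nonneg this
  rw [cosh_dist_hp] at h5
  linarith

theorem sinh_mul_le {t v : ℝ} (ht0 : 0 ≤ t) (ht : t ≤ 1) (hv : 0 ≤ v) : sinh (t * v) ≤ t * sinh v := by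
  have hc : ConvexOn ℝ (Set.Ici 0) sinh := by
    apply convexOn_of_deriv2_nonneg (convex_Ici 0) Real.continuous_sinh.continuousOn
    · exact Real.differentiable_sinh.differentiableOn
    · simp [Real.differentiable_cosh.differentiableOn]
    · intro x hx
      simp at hx
      simp [hx.le]
  have := hc.2 (Set.mem_Ici.2 hv) (Set.mem_Ici.2 le_rfl) ht0 (sub_nonneg.2 ht) (by ring)
  simpa using this

theorem cosh_mul_le {t : ℝ} (u : ℝ) (ht0 : 0 ≤ t) (ht : t ≤ 1) : cosh (t * u) - 1 ≤ t^2 * (cosh u - 1) := by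
  have e : ∀ u, cosh u - 1 = 2 * sinh (u/2) ^2 := fun u => by
    have := Real.cosh_two_mul (u/2)
    rw [Real.cosh_sq, mul_div_cancel₀ _ two_ne_zero] at this
    linarith
  rw [← Real.cosh_abs, ← Real.cosh_abs u, abs_mul, abs_of_nonneg ht0, e, e, mul_div_assoc]
  have h := sinh_mul_le ht0 ht (by positivity : 0 ≤ |u|/2)
  have h0 : 0 ≤ sinh (t * (|u|/2)) := Real.sinh_nonneg_iff.2 (by positivity)
  nlinarith

theorem contr {X : Type*} [MetricSpace X] (hcat : IsCatMinusOne X) (o x y p q : X) (t : ℝ)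
    (ht0 : 0 ≤ t) (ht : t ≤ 1) (hp1 : MetricBtw o p x) (hq1 : MetricBtw o q y)
    (hp2 : dist o p = t * dist o x) (hq2 : dist o q = t * dist o y) :
    cosh (dist p q) - 1 ≤ t^2 * (cosh (dist x y) - 1) := by
  obtain ⟨c, h1, h2, h3, h4⟩ := comp hcat o x y
  have h5 := h4 p q hp1 hq1
  have a1 := cosh_mul_le (dist o x - dist o y) ht0 ht
  have a2 := cosh_mul_le (dist o x + dist o y) ht0 ht
  rw [hp2, hq2] at h5
  rw [h3]
  rw [mul_sub, Real.cosh_sub, Real.cosh_sub] at a1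
  rw [mul_add, Real.cosh_add, Real.cosh_add] at a2
  nlinarith [mul_le_mul_of_nonneg_left a1 (by linarith : 0 ≤ (1+c)/2), mul_le_mul_of_nonneg_left a2 (by linarith : 0 ≤ (1-c)/2)]

theorem half_sq_le_cosh (d : ℝ) : d^2 / 2 ≤ cosh d - 1 := by
  have h := Real.cosh_two_mul (|d|/2)
  rw [Real.cosh_sq, mul_div_cancel₀ _ two_ne_zero, Real.cosh_abs] at h
  have h1 : |d|/2 ≤ sinh (|d|/2) := Real.self_le_sinh_iff.2 (by positivity)
  have h2 := sq_abs d
  nlinarith [abs_nonneg d]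

theorem cosh_tangent (u v : ℝ) : cosh u + (v - u) * sinh u ≤ cosh v := by
  have h := half_sq_le_cosh (v - u)
  have e : cosh v = cosh (v-u) * cosh u + sinh (v-u) * sinh u := by
    rw [← Real.cosh_add]; ring_nf
  have h1 := Real.add_one_le_exp (v - u)
  have h2 := Real.add_one_le_exp (-(v - u))
  have e1 : cosh u = (exp u + exp (-u))/2 := Real.cosh_eq u
  have e2 : sinh u = (exp u - exp (-u))/2 := Real.sinh_eq u
  have e3 : cosh v = (exp u * exp (v-u) + exp (-u) * exp (-(v-u)))/2 := by
    rw [← Real.exp_add, ← Real.exp_add, Real.cosh_eq]; ring_nf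
  rw [e3, e1, e2]
  nlinarith [mul_le_mul_of_nonneg_left h1 (Real.exp_pos u).le, mul_le_mul_of_nonneg_left h2 (Real.exp_pos (-u)).le]

theorem sinh_tangent {r R : ℝ} (hr : 0 ≤ r) (h : r ≤ R) : (R - r) * cosh r ≤ sinh R - sinh r := by
  have e : sinh R = sinh (R-r) * cosh r + cosh (R-r) * sinh r := by
    rw [← Real.sinh_add]; ring_nf
  have h1 : R - r ≤ sinh (R-r) := Real.self_le_sinh_iff.2 (by linarith)
  have h2 := Real.one_le_cosh (R-r)
  have h3 := Real.sinh_nonneg_iff.2 hr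
  have h4 := Real.cosh_pos r
  rw [e]; nlinarith

theorem fixpt {X : Type*} [MetricSpace X]
    [CompleteSpace X] (hgeo : IsGeodesicSpace X) (hcat : IsCatMinusOne X)
    (K : Set X) (hcl : IsClosed K) (hconv : MetricConvex K) (o : X) (ho : o ∈ K) (T : X → X)
    (hT : Set.MapsTo T K K) (hne : ∀ x ∈ K, ∀ y ∈ K, dist (T x) (T y) ≤ dist x y)
    (t : ℝ) (ht0 : 0 ≤ t) (ht : t < 1) :
    ∃ x ∈ K, MetricBtw o x (T x) ∧ dist o x = t * dist o (T x) := by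
  choose P hP1 hP2 using fun y => hgeo o y t ⟨ht0, ht.le⟩
  have hG : ∀ x ∈ K, P (T x) ∈ K := fun x hx => hconv o ho _ (hT hx) _ (hP2 _)
  have hc : ∀ x ∈ K, ∀ y ∈ K, cosh (dist (P (T x)) (P (T y))) - 1 ≤ t^2 * (cosh (dist x y) - 1) := by
    intro x hx y hy
    refine (contr hcat o (T x) (T y) _ _ t ht0 ht.le (hP2 _) (hP2 _) (hP1 _) (hP1 _)).trans ?_
    have : cosh (dist (T x) (T y)) ≤ cosh (dist x y) := Real.cosh_le_cosh.2 (by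
      rw [abs_of_nonneg dist_nonneg, abs_of_nonneg dist_nonneg]; exact hne x hx y hy)
    gcongr
  have hl : ∀ x ∈ K, ∀ y ∈ K, dist (P (T x)) (P (T y)) ≤ dist x y := by
    intro x hx y hy
    have h1 := hc x hx y hy
    have h2 := Real.one_le_cosh (dist x y)
    have h3 : cosh (dist (P (T x)) (P (T y))) ≤ cosh (dist x y) := by
      have : t^2 ≤ 1 := by nlinarith
      nlinarith
    rw [Real.cosh_le_cosh] at h3
    rwa [abs_of_nonneg dist_nonneg, abs_of_nonneg dist_nonneg] at h3
  let z : ℕ → X := fun n => (fun x => P (T x))^[n] o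
  have hzs : ∀ n, z (n+1) = P (T (z n)) := fun n => Function.iterate_succ_apply' _ _ _
  have hzK : ∀ n, z n ∈ K := by
    intro n
    induction n with
    | zero => exact ho
    | succ n ih => rw [hzs]; exact hG _ ih
  set C := cosh (dist (z 0) (z 1)) - 1 with hC
  have hC0 : 0 ≤ C := by have := Real.one_le_cosh (dist (z 0) (z 1)); linarith
  have hd : ∀ n, cosh (dist (z n) (z (n+1))) - 1 ≤ (t^n)^2 * C := by
    intro n
    induction n with
    | zero => simp [hC]
    | succ n ih =>
      rw [hzs n, hzs (n+1)]
      refine (hc _ (hzK _) _ (hzK _)).trans ?_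
      calc _ ≤ t^2 * ((t^n)^2 * C) := by gcongr
        _ = _ := by ring
  have hcs : CauchySeq z := by
    refine cauchySeq_of_le_geometric t (√(2*C)) ht fun n => ?_
    refine abs_le_of_sq_le_sq' ?_ (by positivity) |>.2
    rw [mul_pow, Real.sq_sqrt (by positivity)]
    have := half_sq_le_cosh (dist (z n) (z (n+1)))
    have := hd n
    linarith
  obtain ⟨x, hx⟩ := cauchySeq_tendsto_of_complete hcs
  have hxK : x ∈ K := hcl.mem_of_tendsto hx (Filter.Eventually.of_forall hzK)
  have hfix : P (T x) = x := by
    have h1 : Filter.Tendsto (fun n => z (n+1)) Filter.atTop (nhds x) := hx.comp (Filter.tendsto_add_atTop_nat 1)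
    have h2 : Filter.Tendsto (fun n => z (n+1)) Filter.atTop (nhds (P (T x))) := by
      rw [tendsto_iff_dist_tendsto_zero]
      refine squeeze_zero (fun _ => dist_nonneg) (fun n => ?_) (tendsto_iff_dist_tendsto_zero.1 hx)
      rw [hzs]; exact hl _ (hzK n) _ hxK
    exact tendsto_nhds_unique h2 h1
  refine ⟨x, hxK, ?_, ?_⟩
  · have := hP2 (T x); rwa [hfix] at this
  · have := hP1 (T x); rwa [hfix] at this

theorem angle {X : Type*} [MetricSpace X] (hcat : IsCatMinusOne X) (o x y x' y' : X) (s t : ℝ)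
    (hs0 : 0 < s) (hst : s ≤ t) (ht : t < 1) (hx : MetricBtw o x x') (hy : MetricBtw o y y')
    (hx2 : dist o x = s * dist o x') (hy2 : dist o y = t * dist o y')
    (hd : dist x' y' ≤ dist x y) (hx0 : 0 < dist o x) (hy0 : 0 < dist o y) :
    dist o x ≤ dist o y ∧ ∀ p q, MetricBtw o p x' → MetricBtw o q y' →
      cosh (dist p q) ≤ cosh (dist o p - dist o q) + sinh (dist o p) * sinh (dist o q) *
        (sinh (dist o y - dist o x) / (sinh (dist o y) * cosh (dist o x))) := by
  obtain ⟨c, h1, h2, h3, h4⟩ := comp hcat o x' y'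
  have h5 := h4 x y hx hy
  have h6 : cosh (dist x' y') ≤ cosh (dist x y) := Real.cosh_le_cosh.2 (by
      rw [abs_of_nonneg dist_nonneg, abs_of_nonneg dist_nonneg]; exact hd)
  have hR : dist o x < dist o x' := by nlinarith [dist_nonneg (x := o) (y := x')]
  have hR' : dist o y < dist o y' := by nlinarith [dist_nonneg (x := o) (y := y')]
  have hn : ∀ p q, MetricBtw o p x' → MetricBtw o q y' →
      cosh (dist p q) ≤ cosh (dist o p - dist o q) + sinh (dist o p) * sinh (dist o q) * (1 - c) := by
    intro p q hp hq
    have := h4 p q hp hq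
    rw [Real.cosh_sub]; linarith
  have hdiff : (1 - c) * (sinh (dist o x') * sinh (dist o y') - sinh (dist o x) * sinh (dist o y)) ≤
      cosh (dist o y - dist o x) - cosh (dist o y' - dist o x') := by
    rw [Real.cosh_sub, Real.cosh_sub]; linarith
  clear h4 h5 h6 h3 hd hx hy
  generalize dist o x = r at *
  generalize dist o y = r' at *
  generalize dist o x' = R at *
  generalize dist o y' = R' at *
  have p1 := Real.sinh_pos_iff.2 hx0
  have p2 := Real.sinh_pos_iff.2 hy0
  have q1 := Real.sinh_lt_sinh.2 hR
  have q2 := Real.sinh_lt_sinh.2 hR'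
  have pc := Real.cosh_pos r
  have hle : r ≤ r' := by
    by_contra! hlt
    have : cosh (R' - R) ≤ cosh (r' - r) := by
      have : 0 ≤ (1 - c) * (sinh R * sinh R' - sinh r * sinh r') :=
        mul_nonneg (by linarith) (by nlinarith)
      linarith
    rw [Real.cosh_le_cosh, abs_of_neg (by linarith : r' - r < 0)] at this
    have h := (abs_le.1 this).1
    have : r - r' ≥ s * (R - R') := by nlinarith
    nlinarith
  refine ⟨hle, fun p q hp hq => (hn p q hp hq).trans ?_⟩
  have hc : 1 - c ≤ sinh (r' - r) / (sinh r' * cosh r) := by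
    rw [le_div_iff₀ (by positivity)]
    have t1 := cosh_tangent (r' - r) (R' - R)
    have t2 := sinh_tangent hx0.le hR.le
    have sd := Real.sinh_nonneg_iff.2 (sub_nonneg.2 hle)
    have a1 : (1 - c) * (sinh r' * ((R - r) * cosh r)) ≤ (R - r) * sinh (r' - r) := by
      calc _ ≤ (1 - c) * (sinh R * sinh R' - sinh r * sinh r') := by
            apply mul_le_mul_of_nonneg_left _ (by linarith)
            nlinarith
        _ ≤ _ := hdiff
        _ ≤ _ := by nlinarith
    have : 0 < R - r := by linarith
    refine le_of_mul_le_mul_left ?_ this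
    linarith
  have := Real.sinh_nonneg_iff.2 (dist_nonneg (x := o) (y := p))
  have := Real.sinh_nonneg_iff.2 (dist_nonneg (x := o) (y := q))
  gcongr

theorem ray_imp {X : Type*} [MetricSpace X] (K : Set X) (h : ∀ T : X → X, Set.MapsTo T K K →
      (∀ x ∈ K, ∀ y ∈ K, dist (T x) (T y) ≤ dist x y) → ∃ z ∈ K, T z = z) :
    GeodesicallyBounded K := by
  rintro ⟨c, hc, hcK⟩
  let b : X → ℝ := fun x => ⨅ t : Set.Ici (0:ℝ), (dist x (c t) - t)
  have hbdd : ∀ x, BddBelow (Set.range fun t : Set.Ici (0:ℝ) => (dist x (c t) - t)) := by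
    intro x
    refine ⟨-dist x (c 0), ?_⟩
    rintro _ ⟨⟨t, ht⟩, rfl⟩
    have h1 := dist_triangle_left (c t) (c 0) x
    have ht' : 0 ≤ t := ht
    rw [hc t 0 ht le_rfl, sub_zero, abs_of_nonneg ht'] at h1
    show _ ≤ dist x (c t) - t
    linarith
  have hb1 : ∀ x y, b x ≤ b y + dist x y := by
    intro x y
    rw [← sub_le_iff_le_add]
    refine le_ciInf fun t => ?_
    have := ciInf_le (hbdd x) t
    have := dist_triangle x y (c t)
    show (⨅ t : Set.Ici (0:ℝ), (dist x (c t) - t)) - _ ≤ _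
    linarith
  have hbc : ∀ s, 0 ≤ s → b (c s) = -s := by
    intro s hs
    apply le_antisymm
    · have := ciInf_le (hbdd (c s)) ⟨s, hs⟩
      simpa using this
    · refine le_ciInf fun t => ?_
      rw [hc s t hs t.2]
      linarith [neg_abs_le (s - t)]
  obtain ⟨z, hz, hTz⟩ := h (fun x => c (max 0 (-b x) + 1)) (fun x _ => hcK _ (by positivity)) (by
    intro x _ y _
    rw [hc _ _ (by positivity) (by positivity)]
    have h1 := hb1 x y
    have h2 := hb1 y x
    rw [dist_comm] at h2
    calc _ = |max 0 (-b x) - max 0 (-b y)| := by ring_nf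
      _ ≤ |(-b x) - (-b y)| := by
        rcases max_cases 0 (-b x) with h | h <;> rcases max_cases 0 (-b y) with h' | h' <;> rw [h.1, h'.1] <;> (try rw [abs_le]) <;> (try constructor) <;> linarith [abs_nonneg (-b x - -b y), le_abs_self (-b x - -b y), neg_abs_le (-b x - -b y)]
      _ ≤ _ := by rw [abs_le]; constructor <;> linarith)
  have h1 := hbc (max 0 (-b z) + 1) (by positivity)
  rw [hTz] at h1
  rw [h1, neg_neg] at hTz
  have := le_max_right 0 (-b z)
  linarith

open Filter in
theorem fpp_of_bounded {X : Type*} [MetricSpace X]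
    [CompleteSpace X] (hgeo : IsGeodesicSpace X) (hcat : IsCatMinusOne X)
    (K : Set X) (hne : K.Nonempty) (hcl : IsClosed K) (hconv : MetricConvex K)
    (hgb : GeodesicallyBounded K) (T : X → X) (hT : Set.MapsTo T K K)
    (hT1 : ∀ x ∈ K, ∀ y ∈ K, dist (T x) (T y) ≤ dist x y) : ∃ z ∈ K, T z = z := by
  by_contra! hno
  obtain ⟨o, ho⟩ := hne
  have hpos : ∀ n : ℕ, (0:ℝ) < 1 / ((n:ℝ) + 2) := fun n => by positivity
  have hhalf : ∀ n : ℕ, 1 / ((n:ℝ) + 2) ≤ 1 / 2 := fun n => by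
    apply one_div_le_one_div_of_le <;> linarith [(Nat.cast_nonneg n : (0:ℝ) ≤ n)]
  choose x hxK hxb hxd using fun n : ℕ => fixpt hgeo hcat K hcl hconv o ho T hT hT1
    (1 - 1 / ((n:ℝ) + 2)) (by linarith [hhalf n]) (by linarith [hpos n])
  have hr0 : ∀ n, 0 < dist o (x n) := by
    intro n
    rcases (dist_nonneg (x := o) (y := x n)).eq_or_lt with h | h
    · exfalso
      have h1 := hxd n
      rw [← h] at h1
      have h2 : dist o (T (x n)) = 0 := by
        rcases mul_eq_zero.1 h1.symm with h' | h'
        · linarith [hhalf n]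
        · exact h'
      have e1 := dist_eq_zero.1 h.symm
      have e2 := dist_eq_zero.1 h2
      exact hno _ (hxK n) (e2.symm.trans e1)
    · exact h
  have hang := fun (n m : ℕ) (hnm : n ≤ m) => angle hcat o (x n) (x m) (T (x n)) (T (x m))
    (1 - 1 / ((n:ℝ) + 2)) (1 - 1 / ((m:ℝ) + 2)) (by linarith [hhalf n])
    (by
      have : 1 / ((m:ℝ) + 2) ≤ 1 / ((n:ℝ) + 2) := by gcongr
      linarith) (by linarith [hpos m]) (hxb n) (hxb m) (hxd n) (hxd m)
      (hT1 _ (hxK n) _ (hxK m)) (hr0 n) (hr0 m)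
  set r : ℕ → ℝ := fun n => dist o (x n) with hr
  have hmono : Monotone r := fun n m hnm => (hang n m hnm).1
  by_cases hbd : BddAbove (Set.range r)
  · have hlim := tendsto_atTop_ciSup hmono hbd
    obtain ⟨B, hB⟩ := hbd
    have hB' : ∀ n, r n ≤ B := fun n => hB ⟨n, rfl⟩
    have hcs : CauchySeq x := by
      rw [Metric.cauchySeq_iff']
      intro ε hε
      obtain ⟨N, hN⟩ := Metric.cauchySeq_iff'.1 hlim.cauchySeq (Real.log (1 + ε^2/2))
        (Real.log_pos (by have : 0 < ε^2 := by positivity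
                          linarith))
      refine ⟨N, fun n hn => ?_⟩
      have h1 := (hang N n hn).2 (x N) (x n) (hxb N) (hxb n)
      have h2 := hN n hn
      have hle := hmono hn
      rw [Real.dist_eq, abs_of_nonneg (by linarith), Real.lt_log_iff_exp_lt (by positivity)] at h2
      have h3 : sinh (dist o (x N)) * sinh (dist o (x n)) *
          (sinh (dist o (x n) - dist o (x N)) / (sinh (dist o (x n)) * cosh (dist o (x N)))) ≤
          sinh (dist o (x n) - dist o (x N)) := by
        have p1 := Real.sinh_pos_iff.2 (hr0 n)
        have p2 := Real.cosh_pos (dist o (x N))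
        have p3 := Real.sinh_nonneg_iff.2 (sub_nonneg.2 hle)
        have p4 := (Real.sinh_lt_cosh (dist o (x N))).le
        simp only [hr] at p3
        rw [mul_div_assoc', div_le_iff₀ (by positivity)]
        have := mul_le_mul_of_nonneg_right p4 (mul_nonneg p1.le p3)
        linarith
      rw [← Real.cosh_neg (_ - _), neg_sub] at h1
      have h4 := Real.cosh_add_sinh (r n - r N)
      have h5 := half_sq_le_cosh (dist (x N) (x n))
      rw [dist_comm]
      refine lt_of_pow_lt_pow_left₀ 2 hε.le ?_
      simp only [hr] at h4 h2
      linarith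
    obtain ⟨z, hz⟩ := cauchySeq_tendsto_of_complete hcs
    have hzK : z ∈ K := hcl.mem_of_tendsto hz (Eventually.of_forall hxK)
    refine hno z hzK ?_
    have hTz : Tendsto (fun n => T (x n)) atTop (nhds (T z)) := by
      rw [tendsto_iff_dist_tendsto_zero]
      exact squeeze_zero (fun _ => dist_nonneg) (fun n => hT1 _ (hxK n) _ hzK)
        (tendsto_iff_dist_tendsto_zero.1 hz)
    have hd0 : Tendsto (fun n => dist (T (x n)) (x n)) atTop (nhds 0) := by
      have h1 : Tendsto (fun n : ℕ => (2 * B) * (1 / ((n:ℝ) + 2))) atTop (nhds 0) := by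
        have : Tendsto (fun n : ℕ => 1 / ((n:ℝ) + 2)) atTop (nhds 0) := by
          refine Tendsto.div_atTop tendsto_const_nhds ?_
          exact tendsto_atTop_add_const_right _ _ tendsto_natCast_atTop_atTop
        simpa using this.const_mul (2 * B)
      refine squeeze_zero (fun _ => dist_nonneg) (fun n => ?_) h1
      have h2 := hxb n
      unfold MetricBtw at h2
      have h3 := hxd n
      have h4 := hhalf n
      have h5 := hB' n
      simp only [hr] at h5
      rw [dist_comm]
      have h6 : dist o (T (x n)) ≤ 2 * B := by nlinarith [dist_nonneg (x := o) (y := T (x n))]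
      have h7 := mul_le_mul_of_nonneg_right h6 (hpos n).le
      linarith
    exact dist_eq_zero.1 (tendsto_nhds_unique (hTz.dist hz) hd0)
  · have hrt : Tendsto r atTop atTop := tendsto_atTop_atTop_of_monotone' hmono hbd
    have hct : Tendsto (fun n => cosh (r n)) atTop atTop := by
      refine tendsto_atTop_mono (fun n => ?_) hrt
      have := half_sq_le_cosh (r n)
      nlinarith [sq_nonneg (r n - 1)]
    have hrR : ∀ n, r n ≤ dist o (T (x n)) := by
      intro n
      have h2 := hxb n
      unfold MetricBtw at h2
      have := dist_nonneg (x := x n) (y := T (x n))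
      simp only [hr]; linarith
    choose q hqd hqb using fun (n : ℕ) (ρ : ℝ) => hgeo o (T (x n)) (max 0 (min 1 (ρ / dist o (T (x n)))))
      ⟨le_max_left _ _, max_le zero_le_one (min_le_left _ _)⟩
    have hqd' : ∀ n ρ, 0 ≤ ρ → ρ ≤ r n → dist o (q n ρ) = ρ := by
      intro n ρ h0 h1
      have hR : 0 < dist o (T (x n)) := (hr0 n).trans_le (hrR n)
      have : ρ / dist o (T (x n)) ≤ 1 := by rw [div_le_one hR]; exact h1.trans (hrR n)
      rw [hqd, min_eq_right this, max_eq_right (by positivity)]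
      field_simp
    have hqK : ∀ n ρ, q n ρ ∈ K := fun n ρ => hconv o ho _ (hT (hxK n)) _ (hqb n ρ)
    have hest : ∀ n m, n ≤ m → ∀ ρ σ, 0 ≤ ρ → 0 ≤ σ → ρ ≤ r n → σ ≤ r n →
        cosh (dist (q n ρ) (q m σ)) ≤ cosh (ρ - σ) + sinh ρ * sinh σ / cosh (r n) := by
      intro n m hnm ρ σ h0 h0' h1 h1'
      have h := (hang n m hnm).2 _ _ (hqb n ρ) (hqb m σ)
      rw [hqd' n ρ h0 h1, hqd' m σ h0' (h1'.trans (hmono hnm))] at h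
      refine h.trans ?_
      have p1 := Real.sinh_pos_iff.2 (hr0 m)
      have p2 := Real.cosh_pos (r n)
      have p3 := Real.sinh_nonneg_iff.2 h0
      have p4 := Real.sinh_nonneg_iff.2 h0'
      have p5 : sinh (r m - r n) ≤ sinh (r m) := Real.sinh_le_sinh.2 (by linarith [hr0 n])
      have : sinh (r m - r n) / (sinh (r m) * cosh (r n)) ≤ 1 / cosh (r n) := by
        rw [div_le_div_iff₀ (mul_pos p1 p2) p2]
        nlinarith
      have h7 := mul_le_mul_of_nonneg_left this (mul_nonneg p3 p4)
      rw [mul_one_div] at h7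
      simp only [hr] at h7 ⊢
      linarith
    have hlim : ∀ ρ : ℝ, ∃ y, 0 ≤ ρ → Tendsto (fun n => q n ρ) atTop (nhds y) := by
      intro ρ
      by_cases h0 : 0 ≤ ρ
      · have hcs : CauchySeq (fun n => q n ρ) := by
          rw [Metric.cauchySeq_iff']
          intro ε hε
          have e1 : Tendsto (fun n => sinh ρ * sinh ρ / cosh (r n)) atTop (nhds 0) :=
            Tendsto.div_atTop tendsto_const_nhds hct
          have e2 := e1.eventually_lt_const (show 0 < ε^2/2 by positivity)
          obtain ⟨N, hN1, hN2⟩ := (e2.and (hrt.eventually_ge_atTop ρ)).exists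
          refine ⟨N, fun n hn => ?_⟩
          have h1 := hest N n hn ρ ρ h0 h0 hN2 hN2
          rw [sub_self, Real.cosh_zero] at h1
          have h5 := half_sq_le_cosh (dist (q N ρ) (q n ρ))
          rw [dist_comm]
          refine lt_of_pow_lt_pow_left₀ 2 hε.le ?_
          linarith
        obtain ⟨y, hy⟩ := cauchySeq_tendsto_of_complete hcs
        exact ⟨y, fun _ => hy⟩
      · exact ⟨o, fun h => absurd h h0⟩
    choose c hc using hlim
    refine hgb ⟨c, fun ρ σ h0 h0' => ?_, fun ρ h0 =>
      hcl.mem_of_tendsto (hc ρ h0) (Eventually.of_forall fun n => hqK n ρ)⟩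
    have hd := (hc ρ h0).dist (hc σ h0')
    apply le_antisymm
    · have e1 : Tendsto (fun n => cosh (ρ - σ) + sinh ρ * sinh σ / cosh (r n)) atTop
          (nhds (cosh (ρ - σ) + 0)) :=
        tendsto_const_nhds.add (Tendsto.div_atTop tendsto_const_nhds hct)
      have e2 := (Real.continuous_cosh.tendsto _).comp hd
      have e3 := le_of_tendsto_of_tendsto e2 e1 (by
        filter_upwards [hrt.eventually_ge_atTop ρ, hrt.eventually_ge_atTop σ] with n h1 h2
        exact hest n n le_rfl ρ σ h0 h0' h1 h2)
      rw [add_zero, Real.cosh_le_cosh, abs_of_nonneg dist_nonneg] at e3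
      exact e3
    · refine ge_of_tendsto hd ?_
      filter_upwards [hrt.eventually_ge_atTop ρ, hrt.eventually_ge_atTop σ] with n h1 h2
      have := abs_dist_sub_le (q n ρ) (q n σ) o
      rwa [dist_comm _ o, dist_comm _ o, hqd' n ρ h0 h1, hqd' n σ h0' h2] at this

/-- Main theorem: a nonempty closed convex subset `K` of a complete CAT(-1) space
has the fixed point property for nonexpansive mappings `T : K → K` if and only if
`K` is geodesically bounded. -/
theorem cat_minus_one_fpp_iff_geodesically_bounded {X : Type*} [MetricSpace X]
    [CompleteSpace X] (hgeo : IsGeodesicSpace X) (hcat : IsCatMinusOne X)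
    (K : Set X) (hne : K.Nonempty) (hcl : IsClosed K) (hconv : MetricConvex K) :
    (∀ T : X → X, Set.MapsTo T K K →
      (∀ x ∈ K, ∀ y ∈ K, dist (T x) (T y) ≤ dist x y) → ∃ z ∈ K, T z = z) ↔
    GeodesicallyBounded K := by
  exact ⟨fun h => ray_imp K h, fun h T hT hT1 =>
    fpp_of_bounded hgeo hcat K hne hcl hconv h T hT hT1⟩
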